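/- Let Ω_A be the partition of [0,1]^2 into two sets by the line through (A,0) of slope −1, for A ∈ [0,1] (so the line is y = −x + A, separating the triangle below from the rest). Let P_A be the stratified sample with one uniform point in each of the two parts. Then for A ∈ [0,1], E L2(P_A)^2 = (−135 + 120A + 175A^2 − 288A^3 + 112A^4 − 2A^6) / (360(A^2 − 2)), and this function attains its minimum on [0,1] at A = 1, where its value is 1/20. -/

import Mathlib

open MeasureTheory Set
open scoped ENNReal

/-- The half-open box `[0,x) = ∏_j [0, x_j)`. -/
def box (d : ℕ) (x : Fin d → ℝ) : Set (Fin d → ℝ) :=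
  Set.univ.pi fun j => Set.Ico 0 (x j)

/-- The squared `L2`-discrepancy of the point set `P` in `[0,1]^d`. -/
noncomputable def disc2 (d N : ℕ) (P : Fin N → Fin d → ℝ) : ℝ :=
  ∫ x in Set.Icc (0 : Fin d → ℝ) 1,
    ((Set.ncard {i | P i ∈ box d x} : ℝ) / N - (volume (box d x)).toReal) ^ 2

/-- The uniform probability measure on `Ω` (for a null set, the degenerate sample at
the origin, which is the natural convention for the degenerate triangle `A = 0`). -/
noncomputable def unifOr {d : ℕ} (Ω : Set (Fin d → ℝ)) : Measure (Fin d → ℝ) :=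
  if volume Ω = 0 then Measure.dirac 0 else (volume Ω)⁻¹ • volume.restrict Ω

/-- The triangle `{(x,y) ∈ [0,1]² : x + y ≤ A}`. -/
def triA (A : ℝ) : Set (Fin 2 → ℝ) :=
  {x ∈ Set.Icc (0 : Fin 2 → ℝ) 1 | x 0 + x 1 ≤ A}

/-- Its complementary region `{(x,y) ∈ [0,1]² : x + y ≥ A}`. -/
def triAc (A : ℝ) : Set (Fin 2 → ℝ) :=
  {x ∈ Set.Icc (0 : Fin 2 → ℝ) 1 | A ≤ x 0 + x 1}

/-- The mean squared `L2`-discrepancy of the stratified sample with one uniform point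
in each of the two parts cut by the line `y = −x + A`. -/
noncomputable def EA (A : ℝ) : ℝ :=
  ∫ P, disc2 2 2 P
    ∂(Measure.pi fun i : Fin 2 => unifOr (if i = 0 then triA A else triAc A))

/-- The indicator that the point `p` lies in the box `[0,x)`. -/
noncomputable def boxInd (x p : Fin 2 → ℝ) : ℝ := (box 2 x).indicator 1 p

theorem measurableSet_box (d : ℕ) (x : Fin d → ℝ) : MeasurableSet (box d x) :=
  MeasurableSet.univ_pi fun _ => measurableSet_Ico

theorem boxInd_mem_Icc (x p : Fin 2 → ℝ) : boxInd x p ∈ Icc (0 : ℝ) 1 := by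
  unfold boxInd
  by_cases h : p ∈ box 2 x <;> simp [h]

theorem measurable_boxInd (x : Fin 2 → ℝ) : Measurable (boxInd x) :=
  measurable_one.indicator (measurableSet_box 2 x)

theorem measurable_boxInd_uncurry (i : Fin 2) :
    Measurable fun z : (Fin 2 → Fin 2 → ℝ) × (Fin 2 → ℝ) => boxInd z.2 (z.1 i) := by
  have h : MeasurableSet {z : (Fin 2 → Fin 2 → ℝ) × (Fin 2 → ℝ) | z.1 i ∈ box 2 z.2} := by
    have : {z : (Fin 2 → Fin 2 → ℝ) × (Fin 2 → ℝ) | z.1 i ∈ box 2 z.2}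
        = ⋂ j : Fin 2, ({z | 0 ≤ z.1 i j} ∩ {z | z.1 i j < z.2 j}) := by
      ext z
      simp [box]
    rw [this]
    refine MeasurableSet.iInter fun j => MeasurableSet.inter ?_ ?_
    · exact measurableSet_le (by fun_prop) (by fun_prop)
    · exact measurableSet_lt (by fun_prop) (by fun_prop)
  exact measurable_one.indicator h

theorem ncard_mem_box (P : Fin 2 → Fin 2 → ℝ) (x : Fin 2 → ℝ) :
    (Set.ncard {i | P i ∈ box 2 x} : ℝ) = boxInd x (P 0) + boxInd x (P 1) := by
  classical
  rw [Set.ncard_eq_toFinset_card', Set.toFinset_ofPred, Finset.card_filter, Fin.sum_univ_two]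
  simp [boxInd, Set.indicator_apply]

theorem volume_box_toReal {x : Fin 2 → ℝ} (hx : 0 ≤ x) :
    (volume (box 2 x)).toReal = x 0 * x 1 := by
  unfold box
  have := Real.volume_pi_Ico_toReal (a := (0 : Fin 2 → ℝ)) (b := x) hx
  simpa [Fin.prod_univ_two] using this

theorem integral_boxInd_mul {κ : Fin 2 → Measure (Fin 2 → ℝ)}
    [∀ i, IsProbabilityMeasure (κ i)] (x : Fin 2 → ℝ) :
    ∫ P, boxInd x (P 0) * boxInd x (P 1) ∂Measure.pi κ
      = (κ 0).real (box 2 x) * (κ 1).real (box 2 x) := by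
  have := integral_fintype_prod_eq_prod (μ := κ) (fun _ : Fin 2 => boxInd x)
  simpa only [Fin.prod_univ_two, boxInd,
    integral_indicator_one (measurableSet_box 2 x)] using this

theorem integral_boxInd {κ : Fin 2 → Measure (Fin 2 → ℝ)}
    [∀ i, IsProbabilityMeasure (κ i)] (x : Fin 2 → ℝ) (i : Fin 2) :
    ∫ P, boxInd x (P i) ∂Measure.pi κ = (κ i).real (box 2 x) := by
  rw [integral_comp_eval (measurable_boxInd x).aestronglyMeasurable]
  exact integral_indicator_one (measurableSet_box 2 x)

/-- The expected squared local discrepancy of two independent points that fall into a box of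
volume `v` with probabilities `m` and `n`. -/
noncomputable def localDisc (m n v : ℝ) : ℝ :=
  (m + n + 2 * (m * n)) / 4 - v * (m + n) + v ^ 2

theorem integral_sq_local {κ : Fin 2 → Measure (Fin 2 → ℝ)}
    [∀ i, IsProbabilityMeasure (κ i)] (x : Fin 2 → ℝ) (v : ℝ) :
    ∫ P, ((boxInd x (P 0) + boxInd x (P 1)) / 2 - v) ^ 2 ∂Measure.pi κ
      = localDisc ((κ 0).real (box 2 x)) ((κ 1).real (box 2 x)) v := by
  have hm (i : Fin 2) : Measurable fun P : Fin 2 → Fin 2 → ℝ => boxInd x (P i) :=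
    (measurable_boxInd x).comp (measurable_pi_apply i)
  have hi (i : Fin 2) : Integrable (fun P => boxInd x (P i)) (Measure.pi κ) := by
    refine Integrable.of_bound (hm i).aestronglyMeasurable 1 (ae_of_all _ fun P => ?_)
    have := boxInd_mem_Icc x (P i)
    rw [Real.norm_of_nonneg this.1]
    exact this.2
  have hmul : Integrable (fun P => boxInd x (P 0) * boxInd x (P 1)) (Measure.pi κ) := by
    refine Integrable.of_bound ((hm 0).mul (hm 1)).aestronglyMeasurable 1
      (ae_of_all _ fun P => ?_)
    have h0 := boxInd_mem_Icc x (P 0)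
    have h1 := boxInd_mem_Icc x (P 1)
    rw [Real.norm_of_nonneg (mul_nonneg h0.1 h1.1)]
    exact mul_le_one₀ h0.2 h1.1 h1.2
  have hsq (p : Fin 2 → ℝ) : boxInd x p ^ 2 = boxInd x p := by
    unfold boxInd
    by_cases h : p ∈ box 2 x <;> simp [h]
  have key (P : Fin 2 → Fin 2 → ℝ) :
      ((boxInd x (P 0) + boxInd x (P 1)) / 2 - v) ^ 2
        = (1 / 4 - v) * (boxInd x (P 0) + boxInd x (P 1))
          + 1 / 2 * (boxInd x (P 0) * boxInd x (P 1)) + v ^ 2 := by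
    linear_combination (hsq (P 0) + hsq (P 1)) / 4
  simp_rw [key]
  have hsum := ((hi 0).fun_add (hi 1)).const_mul (1 / 4 - v)
  have hprod := hmul.const_mul (1 / 2)
  rw [integral_add (hsum.fun_add hprod) (integrable_const _), integral_add hsum hprod,
    integral_const_mul, integral_const_mul, integral_add (hi 0) (hi 1),
    integral_boxInd, integral_boxInd, integral_boxInd_mul]
  simp [localDisc]
  ring

theorem integrable_sq_local {κ : Fin 2 → Measure (Fin 2 → ℝ)}
    [∀ i, IsProbabilityMeasure (κ i)] :
    Integrable (Function.uncurry fun (P : Fin 2 → Fin 2 → ℝ) (x : Fin 2 → ℝ) =>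
        ((boxInd x (P 0) + boxInd x (P 1)) / 2 - x 0 * x 1) ^ 2)
      ((Measure.pi κ).prod (volume.restrict (Icc (0 : Fin 2 → ℝ) 1))) := by
  have hm : Measurable (Function.uncurry fun (P : Fin 2 → Fin 2 → ℝ) (x : Fin 2 → ℝ) =>
      ((boxInd x (P 0) + boxInd x (P 1)) / 2 - x 0 * x 1) ^ 2) := by
    have h0 := measurable_boxInd_uncurry 0
    have h1 := measurable_boxInd_uncurry 1
    unfold Function.uncurry
    fun_prop
  have : IsFiniteMeasure (volume.restrict (Icc (0 : Fin 2 → ℝ) 1)) :=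
    isFiniteMeasure_restrict.2 isCompact_Icc.measure_lt_top.ne
  refine Integrable.of_bound hm.aestronglyMeasurable 1 ?_
  rw [← Measure.restrict_univ (μ := Measure.pi κ), Measure.prod_restrict]
  refine ae_restrict_of_forall_mem (MeasurableSet.univ.prod measurableSet_Icc) fun z hz => ?_
  obtain ⟨P, x⟩ := z
  have hx : x ∈ Icc (0 : Fin 2 → ℝ) 1 := hz.2
  have h0 := boxInd_mem_Icc x (P 0)
  have h1 := boxInd_mem_Icc x (P 1)
  have hv0 : 0 ≤ x 0 * x 1 := mul_nonneg (hx.1 0) (hx.1 1)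
  have hv1 : x 0 * x 1 ≤ 1 := mul_le_one₀ (hx.2 0) (hx.1 1) (hx.2 1)
  simp only [Function.uncurry, norm_pow, Real.norm_eq_abs, sq_abs, sq_le_one_iff_abs_le_one]
  rw [abs_le]
  constructor <;> linarith [h0.1, h0.2, h1.1, h1.2]

theorem setIntegral_Icc_finTwo {f : (Fin 2 → ℝ) → ℝ}
    (hf : IntegrableOn f (Icc (0 : Fin 2 → ℝ) 1)) :
    ∫ x in Icc (0 : Fin 2 → ℝ) 1, f x
      = ∫ s in (0 : ℝ)..1, ∫ t in (0 : ℝ)..1, f ![s, t] := by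
  have e := (volume_preserving_finTwoArrow ℝ).symm
  have hpre : MeasurableEquiv.finTwoArrow.symm ⁻¹' Icc (0 : Fin 2 → ℝ) 1
      = Icc (0 : ℝ) 1 ×ˢ Icc (0 : ℝ) 1 := by
    ext ⟨s, t⟩
    simp [MeasurableEquiv.finTwoArrow, Pi.le_def, Fin.forall_fin_two]
  have hemb := MeasurableEquiv.measurableEmbedding
    (MeasurableEquiv.finTwoArrow (α := ℝ)).symm
  rw [← e.setIntegral_preimage_emb hemb, hpre, Measure.volume_eq_prod, setIntegral_prod]
  · rw [intervalIntegral.integral_of_le zero_le_one, integral_Icc_eq_integral_Ioc]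
    refine setIntegral_congr_fun measurableSet_Ioc fun s _ => ?_
    rw [intervalIntegral.integral_of_le zero_le_one, integral_Icc_eq_integral_Ioc]
    rfl
  · rw [← Measure.volume_eq_prod, ← hpre]
    exact (e.integrableOn_comp_preimage hemb).2 hf

theorem integral_disc2 {κ : Fin 2 → Measure (Fin 2 → ℝ)}
    [∀ i, IsProbabilityMeasure (κ i)] :
    ∫ P, disc2 2 2 P ∂Measure.pi κ
      = ∫ s in (0 : ℝ)..1, ∫ t in (0 : ℝ)..1,
          localDisc ((κ 0).real (box 2 ![s, t])) ((κ 1).real (box 2 ![s, t])) (s * t) := by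
  have h (P : Fin 2 → Fin 2 → ℝ) : disc2 2 2 P = ∫ x in Icc (0 : Fin 2 → ℝ) 1,
      ((boxInd x (P 0) + boxInd x (P 1)) / 2 - x 0 * x 1) ^ 2 := by
    refine setIntegral_congr_fun measurableSet_Icc fun x hx => ?_
    simp [ncard_mem_box, volume_box_toReal hx.1]
  simp_rw [h]
  rw [integral_integral_swap integrable_sq_local]
  simp_rw [integral_sq_local]
  rw [setIntegral_Icc_finTwo]
  · rfl
  · have := (integrable_sq_local (κ := κ)).integral_prod_right
    simp only [Function.uncurry, integral_sq_local] at this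
    exact this

instance isProbabilityMeasure_unifOr {d : ℕ} (Ω : Set (Fin d → ℝ)) [Fact (volume Ω ≠ ∞)] :
    IsProbabilityMeasure (unifOr Ω) := by
  unfold unifOr
  split_ifs with h
  · infer_instance
  · constructor
    simp [ENNReal.inv_mul_cancel h (Fact.out : volume Ω ≠ ∞)]

theorem unifOr_real {d : ℕ} {Ω B : Set (Fin d → ℝ)} (h : volume Ω ≠ 0) (hB : MeasurableSet B) :
    (unifOr Ω).real B = volume.real (B ∩ Ω) / volume.real Ω := by
  simp [unifOr, h, Measure.real, Measure.restrict_apply hB, div_eq_inv_mul]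

theorem volume_finTwo (S : Set (Fin 2 → ℝ)) :
    volume S = volume {p : ℝ × ℝ | ![p.1, p.2] ∈ S} :=
  ((volume_preserving_finTwoArrow ℝ).symm.measure_preimage_equiv S).symm

theorem volume_antidiagonal (A : ℝ) : volume {x : Fin 2 → ℝ | x 0 + x 1 = A} = 0 := by
  have hm : MeasurableSet {p : ℝ × ℝ | p.1 + p.2 = A} :=
    measurableSet_eq_fun (by fun_prop) measurable_const
  have h : volume {p : ℝ × ℝ | p.1 + p.2 = A} = 0 := by
    rw [Measure.volume_eq_prod, Measure.measure_prod_null hm]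
    refine ae_of_all _ fun s => ?_
    have : Prod.mk s ⁻¹' {p : ℝ × ℝ | p.1 + p.2 = A} = {A - s} := by
      ext t
      simp [eq_sub_iff_add_eq']
    simp [this]
  simpa [volume_finTwo {x : Fin 2 → ℝ | x 0 + x 1 = A}] using h

/-- The area of `{(s,t) : 0 ≤ s < x, 0 ≤ t < y, s + t ≤ A}`. -/
noncomputable def capArea (A x y : ℝ) : ℝ :=
  (A ^ 2 - max 0 (A - x) ^ 2 - max 0 (A - y) ^ 2 + max 0 (A - y - x) ^ 2) / 2

theorem integral_max_zero_sub {x : ℝ} (hx : 0 ≤ x) (c : ℝ) :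
    ∫ s in (0 : ℝ)..x, max 0 (c - s) = (max 0 c ^ 2 - max 0 (c - x) ^ 2) / 2 := by
  have hlin (a b : ℝ) (hab : a ≤ b) (hbc : b ≤ c) :
      ∫ s in a..b, max 0 (c - s) = ((c - a) ^ 2 - (c - b) ^ 2) / 2 := by
    have : ∫ s in a..b, max 0 (c - s) = ∫ s in a..b, (c - s) := by
      refine intervalIntegral.integral_congr fun s hs => ?_
      rw [uIcc_of_le hab] at hs
      exact max_eq_right (by linarith [hs.2])
    rw [this, intervalIntegral.integral_comp_sub_left (fun u => u) c, integral_id]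
  have hzero (a b : ℝ) (hab : a ≤ b) (hca : c ≤ a) : ∫ s in a..b, max 0 (c - s) = 0 := by
    have : ∫ s in a..b, max 0 (c - s) = ∫ s in a..b, (0 : ℝ) := by
      refine intervalIntegral.integral_congr fun s hs => ?_
      rw [uIcc_of_le hab] at hs
      exact max_eq_left (by linarith [hs.1])
    simp [this]
  rcases le_total c 0 with hc | hc
  · rw [hzero 0 x hx hc, max_eq_left hc, max_eq_left (by linarith)]
    simp
  rcases le_total c x with hcx | hcx
  · have hint (a b : ℝ) : IntervalIntegrable (fun s => max 0 (c - s)) volume a b :=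
      (by fun_prop : Continuous fun s => max 0 (c - s)).intervalIntegrable a b
    rw [← intervalIntegral.integral_add_adjacent_intervals (hint 0 c) (hint c x),
      hlin 0 c hc le_rfl, hzero c x hcx le_rfl, max_eq_right hc,
      max_eq_left (by linarith : c - x ≤ 0)]
    ring
  · rw [hlin 0 x hx hcx, max_eq_right hc, max_eq_right (by linarith : 0 ≤ c - x)]
    ring

theorem volume_slice {y : ℝ} (hy : 0 ≤ y) (c : ℝ) :
    volume {t : ℝ | 0 ≤ t ∧ t < y ∧ t ≤ c} = ENNReal.ofReal (max 0 c - max 0 (c - y)) := by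
  rcases le_total y c with h | h
  · have : {t : ℝ | 0 ≤ t ∧ t < y ∧ t ≤ c} = Ico 0 y := by
      ext t
      exact ⟨fun ht => ⟨ht.1, ht.2.1⟩, fun ht => ⟨ht.1, ht.2, ht.2.le.trans h⟩⟩
    rw [this, Real.volume_Ico, max_eq_right (hy.trans h), max_eq_right (by linarith)]
    congr 1
    ring
  · have hae : volume {t : ℝ | 0 ≤ t ∧ t < y ∧ t ≤ c} = volume (Icc 0 c) := by
      refine le_antisymm (measure_mono fun t ht => ⟨ht.1, ht.2.2⟩) ?_
      rw [← measure_congr Ico_ae_eq_Icc]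
      exact measure_mono fun t ht => ⟨ht.1, ht.2.trans_le h, ht.2.le⟩
    rw [hae, Real.volume_Icc, max_eq_left (by linarith : c - y ≤ 0)]
    simp

theorem volume_cap {A x y : ℝ} (hA : 0 ≤ A) (hx : 0 ≤ x) (hy : 0 ≤ y) :
    volume.real (box 2 ![x, y] ∩ {z | z 0 + z 1 ≤ A}) = capArea A x y := by
  have hset : {p : ℝ × ℝ | ![p.1, p.2] ∈ box 2 ![x, y] ∩ {z | z 0 + z 1 ≤ A}}
      = {p | p.1 ∈ Ico 0 x ∧ 0 ≤ p.2 ∧ p.2 < y ∧ p.2 ≤ A - p.1} := by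
    ext p
    simp [box, Fin.forall_fin_two, le_sub_iff_add_le']
    tauto
  have hmeas : MeasurableSet {p : ℝ × ℝ | p.1 ∈ Ico 0 x ∧ 0 ≤ p.2 ∧ p.2 < y ∧ p.2 ≤ A - p.1} := by
    refine (measurable_fst measurableSet_Ico).inter (MeasurableSet.inter ?_ (.inter ?_ ?_))
    · exact measurableSet_le measurable_const measurable_snd
    · exact measurableSet_lt measurable_snd measurable_const
    · exact measurableSet_le measurable_snd (by fun_prop)
  have hslice (s : ℝ) :
      volume (Prod.mk s ⁻¹' {p : ℝ × ℝ | p.1 ∈ Ico 0 x ∧ 0 ≤ p.2 ∧ p.2 < y ∧ p.2 ≤ A - p.1})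
        = (Ico 0 x).indicator
            (fun s => ENNReal.ofReal (max 0 (A - s) - max 0 (A - y - s))) s := by
    by_cases hs : s ∈ Ico 0 x
    · rw [indicator_of_mem hs, sub_right_comm A y s, ← volume_slice hy]
      congr 1
      ext t
      simp only [mem_preimage, mem_ofPred_eq, hs, true_and]
    · rw [indicator_of_notMem hs]
      convert measure_empty (μ := (volume : Measure ℝ))
      ext t
      simp only [mem_preimage, mem_ofPred_eq, hs, false_and, mem_empty_iff_false]
  have hint (c a b : ℝ) : IntervalIntegrable (fun s => max 0 (c - s)) volume a b :=
    (by fun_prop : Continuous fun s => max 0 (c - s)).intervalIntegrable a b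
  have hnn (s : ℝ) : 0 ≤ max 0 (A - s) - max 0 (A - y - s) :=
    sub_nonneg.2 (max_le_max le_rfl (by linarith))
  rw [Measure.real, volume_finTwo, hset, Measure.volume_eq_prod, Measure.prod_apply hmeas]
  simp_rw [hslice]
  rw [lintegral_indicator measurableSet_Ico,
    ← integral_eq_lintegral_of_nonneg_ae (ae_of_all _ hnn)
      (by fun_prop : Continuous fun s =>
        max 0 (A - s) - max 0 (A - y - s)).aestronglyMeasurable,
    integral_Ico_eq_integral_Ioo, ← integral_Ioc_eq_integral_Ioo,
    ← intervalIntegral.integral_of_le hx,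
    intervalIntegral.integral_sub (hint _ _ _) (hint _ _ _), integral_max_zero_sub hx,
    integral_max_zero_sub hx, max_eq_right hA, capArea]
  ring

theorem box_subset_Icc {x : Fin 2 → ℝ} (hx : x ≤ 1) : box 2 x ⊆ Icc 0 1 := fun _ hp =>
  ⟨fun j => (hp j trivial).1, fun j => (hp j trivial).2.le.trans (hx j)⟩

theorem volume_box_inter_triA {A s t : ℝ} (hA : 0 ≤ A) (hs : s ∈ Icc (0 : ℝ) 1)
    (ht : t ∈ Icc (0 : ℝ) 1) : volume.real (box 2 ![s, t] ∩ triA A) = capArea A s t := by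
  rw [← volume_cap hA hs.1 ht.1]
  congr 1
  have hsub : box 2 ![s, t] ⊆ Icc 0 1 :=
    box_subset_Icc fun j => by fin_cases j <;> simp [hs.2, ht.2]
  ext z
  exact ⟨fun h => ⟨h.1, h.2.2⟩, fun h => ⟨h.1, hsub h.1, h.2⟩⟩

theorem volume_triA {A : ℝ} (hA : A ∈ Icc (0 : ℝ) 1) : volume.real (triA A) = A ^ 2 / 2 := by
  have h : triA A = box 2 ![2, 2] ∩ {z | z 0 + z 1 ≤ A} := by
    ext z
    simp only [triA, box, mem_ofPred_eq, mem_Icc, Pi.le_def, Fin.forall_fin_two, mem_inter_iff,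
      mem_univ_pi, mem_Ico, Pi.zero_apply, Pi.one_apply, Matrix.cons_val_zero, Matrix.cons_val_one]
    constructor
    · rintro ⟨⟨⟨h0, h1⟩, h2, h3⟩, h4⟩
      refine ⟨⟨⟨h0, ?_⟩, h1, ?_⟩, h4⟩ <;> linarith
    · rintro ⟨⟨⟨h0, -⟩, h1, -⟩, h4⟩
      refine ⟨⟨⟨h0, h1⟩, ?_, ?_⟩, h4⟩ <;> linarith [hA.2]
  rw [h, volume_cap hA.1 zero_le_two zero_le_two, capArea, max_eq_left (by linarith [hA.2]),
    max_eq_left (by linarith [hA.2])]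
  ring

theorem volume_inter_triA_add_triAc {A : ℝ} {B : Set (Fin 2 → ℝ)} (hB : B ⊆ Icc 0 1) :
    volume.real (B ∩ triA A) + volume.real (B ∩ triAc A) = volume.real B := by
  have hfin (C : Set (Fin 2 → ℝ)) : volume (B ∩ C) ≠ ∞ :=
    ((measure_mono (inter_subset_left.trans hB)).trans_lt isCompact_Icc.measure_lt_top).ne
  have hm : MeasurableSet {x : Fin 2 → ℝ | x 0 + x 1 ≤ A} :=
    measurableSet_le (by fun_prop) measurable_const
  have hA : B ∩ triA A = B ∩ {x | x 0 + x 1 ≤ A} := by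
    ext z
    exact ⟨fun h => ⟨h.1, h.2.2⟩, fun h => ⟨h.1, hB h.1, h.2⟩⟩
  have hAc : volume.real (B ∩ triAc A) = volume.real (B \ {x | x 0 + x 1 ≤ A}) := by
    refine measureReal_congr (ae_eq_set.2 ⟨?_, ?_⟩)
    · refine measure_mono_null (fun z hz => ?_) (volume_antidiagonal A)
      have h1 : A ≤ z 0 + z 1 := hz.1.2.2
      have h2 : z 0 + z 1 ≤ A := by
        by_contra h
        exact hz.2 ⟨hz.1.1, h⟩
      exact le_antisymm h2 h1
    · convert measure_empty (μ := (volume : Measure (Fin 2 → ℝ)))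
      refine sdiff_eq_empty.2 fun z hz => ⟨hz.1, hB hz.1, ?_⟩
      exact (not_le.1 hz.2).le
  rw [hA, hAc]
  exact measureReal_inter_add_sdiff hm (by simpa using hfin univ)

theorem volume_triAc {A : ℝ} (hA : A ∈ Icc (0 : ℝ) 1) :
    volume.real (triAc A) = 1 - A ^ 2 / 2 := by
  have h := volume_inter_triA_add_triAc (A := A) (B := Icc 0 1) Subset.rfl
  have h1 : Icc (0 : Fin 2 → ℝ) 1 ∩ triA A = triA A := inter_eq_right.2 fun _ hx => hx.1
  have h2 : Icc (0 : Fin 2 → ℝ) 1 ∩ triAc A = triAc A := inter_eq_right.2 fun _ hx => hx.1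
  have h3 : volume.real (Icc (0 : Fin 2 → ℝ) 1) = 1 := by
    simp [Measure.real, Real.volume_Icc_pi]
  rw [h1, h2, h3, volume_triA hA] at h
  linarith

theorem volume_box_inter_triAc {A s t : ℝ} (hA : 0 ≤ A) (hs : s ∈ Icc (0 : ℝ) 1)
    (ht : t ∈ Icc (0 : ℝ) 1) :
    volume.real (box 2 ![s, t] ∩ triAc A) = s * t - capArea A s t := by
  have h := volume_inter_triA_add_triAc (A := A) (B := box 2 ![s, t])
    (box_subset_Icc fun j => by fin_cases j <;> simp [hs.2, ht.2])
  have hv : volume.real (box 2 ![s, t]) = s * t :=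
    volume_box_toReal (x := ![s, t]) fun j => by fin_cases j <;> simp [hs.1, ht.1]
  rw [volume_box_inter_triA hA hs ht, hv] at h
  linarith

theorem continuous_capArea (A : ℝ) : Continuous fun p : ℝ × ℝ => capArea A p.1 p.2 := by
  unfold capArea
  fun_prop

theorem integral_quintic (a b k₀ k₁ k₂ k₃ k₄ k₅ : ℝ) :
    ∫ t in a..b, (k₀ + k₁ * t + k₂ * t ^ 2 + k₃ * t ^ 3 + k₄ * t ^ 4 + k₅ * t ^ 5)
      = k₀ * (b - a) + k₁ * (b ^ 2 - a ^ 2) / 2 + k₂ * (b ^ 3 - a ^ 3) / 3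
        + k₃ * (b ^ 4 - a ^ 4) / 4 + k₄ * (b ^ 5 - a ^ 5) / 5 + k₅ * (b ^ 6 - a ^ 6) / 6 := by
  have hd (t : ℝ) : HasDerivAt
      (fun t => k₀ * t + k₁ * t ^ 2 / 2 + k₂ * t ^ 3 / 3 + k₃ * t ^ 4 / 4 + k₄ * t ^ 5 / 5
        + k₅ * t ^ 6 / 6)
      (k₀ + k₁ * t + k₂ * t ^ 2 + k₃ * t ^ 3 + k₄ * t ^ 4 + k₅ * t ^ 5) t := by
    have hp (n : ℕ) (c k : ℝ) := ((hasDerivAt_pow n t).const_mul k).div_const c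
    refine (((((((hasDerivAt_id' t).const_mul k₀).fun_add (hp 2 2 k₁)).fun_add (hp 3 3 k₂)).fun_add
      (hp 4 4 k₃)).fun_add (hp 5 5 k₄)).fun_add (hp 6 6 k₅)).congr_deriv ?_
    push_cast
    ring
  rw [intervalIntegral.integral_eq_sub_of_hasDerivAt (fun t _ => hd t)
    ((by fun_prop : Continuous fun t : ℝ =>
      k₀ + k₁ * t + k₂ * t ^ 2 + k₃ * t ^ 3 + k₄ * t ^ 4 + k₅ * t ^ 5).intervalIntegrable a b)]
  ring

/-- The general quadratic integrand in the cap area `q` and the box volume `v`. -/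
def quadForm (c₁ c₂ c₃ c₄ c₅ q v : ℝ) : ℝ :=
  c₁ * q + c₂ * v + c₃ * (q * v) + c₄ * q ^ 2 + c₅ * v ^ 2

theorem continuous_quadForm_capArea (A c₁ c₂ c₃ c₄ c₅ : ℝ) :
    Continuous fun p : ℝ × ℝ => quadForm c₁ c₂ c₃ c₄ c₅ (capArea A p.1 p.2) (p.1 * p.2) := by
  have := continuous_capArea A
  unfold quadForm
  fun_prop

theorem integral_quadForm_of_le {A s : ℝ} (hA : A ≤ 1) (hs : 0 ≤ s) (hsA : s ≤ A)
    (c₁ c₂ c₃ c₄ c₅ : ℝ) :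
    ∫ t in (0 : ℝ)..1, quadForm c₁ c₂ c₃ c₄ c₅ (capArea A s t) (s * t)
      = 0 + (c₁ * (A - A ^ 2 / 2) + c₂ / 2) * s
        + (c₁ * (A / 2 - 1 / 2) + c₃ * (A / 2 - A ^ 3 / 6) + c₄ * (A ^ 2 - 2 / 3 * A ^ 3)
            + c₅ / 3) * s ^ 2
        + (-c₁ / 6 + c₃ * (A ^ 2 / 4 - 1 / 4) + c₄ * (A ^ 2 - A)) * s ^ 3
        + (-c₃ * A / 6 + c₄ * (1 / 4 - 7 / 12 * A)) * s ^ 4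
        + (c₃ / 24 + 2 / 15 * c₄) * s ^ 5 := by
  have hint (a b : ℝ) : IntervalIntegrable
      (fun t => quadForm c₁ c₂ c₃ c₄ c₅ (capArea A s t) (s * t)) volume a b :=
    ((continuous_quadForm_capArea A c₁ c₂ c₃ c₄ c₅).comp
      (by fun_prop : Continuous fun t : ℝ => (s, t))).intervalIntegrable a b
  have h1 : ∫ t in (0 : ℝ)..(A - s), quadForm c₁ c₂ c₃ c₄ c₅ (capArea A s t) (s * t)
      = ∫ t in (0 : ℝ)..(A - s), (0 + (c₁ + c₂) * s * t + (c₃ + c₄ + c₅) * s ^ 2 * t ^ 2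
          + 0 * t ^ 3 + 0 * t ^ 4 + 0 * t ^ 5) := by
    refine intervalIntegral.integral_congr fun t ht => ?_
    rw [uIcc_of_le (by linarith)] at ht
    simp only [quadForm, capArea]
    rw [max_eq_right (by linarith : 0 ≤ A - s), max_eq_right (by linarith [ht.2] : 0 ≤ A - t),
      max_eq_right (by linarith [ht.2] : 0 ≤ A - t - s)]
    ring
  have h2 : ∫ t in (A - s)..A, quadForm c₁ c₂ c₃ c₄ c₅ (capArea A s t) (s * t)
      = ∫ t in (A - s)..A, ((c₁ * (-(A - s) ^ 2 / 2) + c₄ * (-(A - s) ^ 2 / 2) ^ 2)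
          + (c₁ * A + c₂ * s + c₃ * s * (-(A - s) ^ 2 / 2)
              + 2 * c₄ * (-(A - s) ^ 2 / 2) * A) * t
          + (-c₁ / 2 + c₃ * s * A + c₄ * (A ^ 2 - (-(A - s) ^ 2 / 2)) + c₅ * s ^ 2) * t ^ 2
          + (-c₃ * s / 2 - c₄ * A) * t ^ 3 + c₄ / 4 * t ^ 4 + 0 * t ^ 5) := by
    refine intervalIntegral.integral_congr fun t ht => ?_
    rw [uIcc_of_le (by linarith)] at ht
    simp only [quadForm, capArea]
    rw [max_eq_right (by linarith : 0 ≤ A - s), max_eq_right (by linarith [ht.2] : 0 ≤ A - t),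
      max_eq_left (by linarith [ht.1] : A - t - s ≤ 0)]
    ring
  have h3 : ∫ t in A..1, quadForm c₁ c₂ c₃ c₄ c₅ (capArea A s t) (s * t)
      = ∫ t in A..1, ((c₁ * ((A ^ 2 - (A - s) ^ 2) / 2) + c₄ * ((A ^ 2 - (A - s) ^ 2) / 2) ^ 2)
          + (c₂ * s + c₃ * s * ((A ^ 2 - (A - s) ^ 2) / 2)) * t
          + c₅ * s ^ 2 * t ^ 2 + 0 * t ^ 3 + 0 * t ^ 4 + 0 * t ^ 5) := by
    refine intervalIntegral.integral_congr fun t ht => ?_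
    rw [uIcc_of_le hA] at ht
    simp only [quadForm, capArea]
    rw [max_eq_right (by linarith : 0 ≤ A - s), max_eq_left (by linarith [ht.1] : A - t ≤ 0),
      max_eq_left (by linarith [ht.1] : A - t - s ≤ 0)]
    ring
  rw [← intervalIntegral.integral_add_adjacent_intervals (hint 0 A) (hint A 1),
    ← intervalIntegral.integral_add_adjacent_intervals (hint 0 (A - s)) (hint (A - s) A),
    h1, h2, h3, integral_quintic, integral_quintic, integral_quintic]
  ring

theorem integral_quadForm_of_ge {A s : ℝ} (hA₀ : 0 ≤ A) (hA : A ≤ 1) (hsA : A ≤ s)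
    (c₁ c₂ c₃ c₄ c₅ : ℝ) :
    ∫ t in (0 : ℝ)..1, quadForm c₁ c₂ c₃ c₄ c₅ (capArea A s t) (s * t)
      = (c₁ * (A ^ 2 / 2 - A ^ 3 / 6) + c₄ * (A ^ 4 / 4 - 7 / 60 * A ^ 5))
        + (c₂ / 2 + c₃ * (A ^ 2 / 4 - A ^ 4 / 24)) * s + c₅ / 3 * s ^ 2
        + 0 * s ^ 3 + 0 * s ^ 4 + 0 * s ^ 5 := by
  have hint (a b : ℝ) : IntervalIntegrable
      (fun t => quadForm c₁ c₂ c₃ c₄ c₅ (capArea A s t) (s * t)) volume a b :=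
    ((continuous_quadForm_capArea A c₁ c₂ c₃ c₄ c₅).comp
      (by fun_prop : Continuous fun t : ℝ => (s, t))).intervalIntegrable a b
  have h1 : ∫ t in (0 : ℝ)..A, quadForm c₁ c₂ c₃ c₄ c₅ (capArea A s t) (s * t)
      = ∫ t in (0 : ℝ)..A, (0 + (c₁ * A + c₂ * s) * t
          + (-c₁ / 2 + c₃ * s * A + c₄ * A ^ 2 + c₅ * s ^ 2) * t ^ 2
          + (-c₃ * s / 2 - c₄ * A) * t ^ 3 + c₄ / 4 * t ^ 4 + 0 * t ^ 5) := by
    refine intervalIntegral.integral_congr fun t ht => ?_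
    rw [uIcc_of_le hA₀] at ht
    simp only [quadForm, capArea]
    rw [max_eq_left (by linarith : A - s ≤ 0), max_eq_right (by linarith [ht.2] : 0 ≤ A - t),
      max_eq_left (by linarith [ht.1] : A - t - s ≤ 0)]
    ring
  have h2 : ∫ t in A..1, quadForm c₁ c₂ c₃ c₄ c₅ (capArea A s t) (s * t)
      = ∫ t in A..1, ((c₁ * (A ^ 2 / 2) + c₄ * (A ^ 2 / 2) ^ 2)
          + (c₂ * s + c₃ * s * (A ^ 2 / 2)) * t
          + c₅ * s ^ 2 * t ^ 2 + 0 * t ^ 3 + 0 * t ^ 4 + 0 * t ^ 5) := by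
    refine intervalIntegral.integral_congr fun t ht => ?_
    rw [uIcc_of_le hA] at ht
    simp only [quadForm, capArea]
    rw [max_eq_left (by linarith : A - s ≤ 0), max_eq_left (by linarith [ht.1] : A - t ≤ 0),
      max_eq_left (by linarith [ht.1] : A - t - s ≤ 0)]
    ring
  rw [← intervalIntegral.integral_add_adjacent_intervals (hint 0 A) (hint A 1),
    h1, h2, integral_quintic, integral_quintic]
  ring

theorem integral_integral_quadForm {A : ℝ} (hA : A ∈ Icc (0 : ℝ) 1) (c₁ c₂ c₃ c₄ c₅ : ℝ) :
    ∫ s in (0 : ℝ)..1, ∫ t in (0 : ℝ)..1, quadForm c₁ c₂ c₃ c₄ c₅ (capArea A s t) (s * t)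
      = c₁ * (A ^ 2 / 2 - A ^ 3 / 3 + A ^ 4 / 24) + c₂ / 4
        + c₃ * (A ^ 2 / 8 - A ^ 4 / 24 + A ^ 6 / 720)
        + c₄ * (A ^ 4 / 4 - 7 / 30 * A ^ 5 + A ^ 6 / 20) + c₅ / 9 := by
  have hcont : Continuous fun s : ℝ =>
      ∫ t in (0 : ℝ)..1, quadForm c₁ c₂ c₃ c₄ c₅ (capArea A s t) (s * t) :=
    intervalIntegral.continuous_parametric_intervalIntegral_of_continuous'
      (continuous_quadForm_capArea A c₁ c₂ c₃ c₄ c₅) 0 1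
  rw [← intervalIntegral.integral_add_adjacent_intervals (hcont.intervalIntegrable 0 A)
    (hcont.intervalIntegrable A 1)]
  have h1 := intervalIntegral.integral_congr (μ := volume) fun s (hs : s ∈ uIcc 0 A) =>
    integral_quadForm_of_le hA.2 (uIcc_of_le hA.1 ▸ hs).1 (uIcc_of_le hA.1 ▸ hs).2 c₁ c₂ c₃ c₄ c₅
  have h2 := intervalIntegral.integral_congr (μ := volume) fun s (hs : s ∈ uIcc A 1) =>
    integral_quadForm_of_ge hA.1 hA.2 (uIcc_of_le hA.2 ▸ hs).1 c₁ c₂ c₃ c₄ c₅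
  rw [h1, h2, integral_quintic, integral_quintic]
  ring

theorem intervalIntegral_zero_one_congr {f g : ℝ → ℝ → ℝ}
    (h : ∀ s ∈ Ioc (0 : ℝ) 1, ∀ t ∈ Ioc (0 : ℝ) 1, f s t = g s t) :
    ∫ s in (0 : ℝ)..1, ∫ t in (0 : ℝ)..1, f s t
      = ∫ s in (0 : ℝ)..1, ∫ t in (0 : ℝ)..1, g s t := by
  simp_rw [intervalIntegral.integral_of_le (zero_le_one' ℝ)]
  exact setIntegral_congr_fun measurableSet_Ioc fun s hs =>
    setIntegral_congr_fun measurableSet_Ioc fun t ht => h s hs t ht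

theorem EA_eq_integral (A : ℝ) :
    EA A = ∫ s in (0 : ℝ)..1, ∫ t in (0 : ℝ)..1,
      localDisc ((unifOr (triA A)).real (box 2 ![s, t]))
        ((unifOr (triAc A)).real (box 2 ![s, t])) (s * t) := by
  have hfin {Ω : Set (Fin 2 → ℝ)} (h : Ω ⊆ Icc 0 1) : Fact (volume Ω ≠ ∞) :=
    ⟨((measure_mono h).trans_lt isCompact_Icc.measure_lt_top).ne⟩
  have (i : Fin 2) : IsProbabilityMeasure (unifOr (if i = 0 then triA A else triAc A)) := by
    have : Fact (volume (if i = 0 then triA A else triAc A) ≠ ∞) := by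
      split_ifs
      · exact hfin fun _ hx => hx.1
      · exact hfin fun _ hx => hx.1
    infer_instance
  exact integral_disc2

theorem unifOr_triAc_real_box {A s t : ℝ} (hA : A ∈ Icc (0 : ℝ) 1) (hs : s ∈ Icc (0 : ℝ) 1)
    (ht : t ∈ Icc (0 : ℝ) 1) :
    (unifOr (triAc A)).real (box 2 ![s, t]) = (s * t - capArea A s t) / (1 - A ^ 2 / 2) := by
  have h0 : volume (triAc A) ≠ 0 := fun h => by
    have := volume_triAc hA
    rw [Measure.real, h, ENNReal.toReal_zero] at this
    nlinarith [hA.1, hA.2]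
  rw [unifOr_real h0 (measurableSet_box 2 _), volume_box_inter_triAc hA.1 hs ht, volume_triAc hA]

theorem unifOr_triA_real_box {A s t : ℝ} (hA : A ∈ Ioc (0 : ℝ) 1) (hs : s ∈ Icc (0 : ℝ) 1)
    (ht : t ∈ Icc (0 : ℝ) 1) :
    (unifOr (triA A)).real (box 2 ![s, t]) = capArea A s t / (A ^ 2 / 2) := by
  have h0 : volume (triA A) ≠ 0 := fun h => by
    have := volume_triA (Ioc_subset_Icc_self hA)
    rw [Measure.real, h, ENNReal.toReal_zero] at this
    nlinarith [hA.1]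
  rw [unifOr_real h0 (measurableSet_box 2 _), volume_box_inter_triA hA.1.le hs ht,
    volume_triA (Ioc_subset_Icc_self hA)]

theorem unifOr_triA_zero_real_box {s t : ℝ} (hs : 0 < s) (ht : 0 < t) :
    (unifOr (triA 0)).real (box 2 ![s, t]) = 1 := by
  have h0 : volume (triA 0) = 0 := measure_mono_null
    (fun z hz => le_antisymm hz.2 (add_nonneg (hz.1.1 0) (hz.1.1 1))) (volume_antidiagonal 0)
  have hmem : (0 : Fin 2 → ℝ) ∈ box 2 ![s, t] := by
    simp [box, Fin.forall_fin_two, hs, ht]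
  simp [unifOr, h0, Measure.real, Measure.dirac_apply' _ (measurableSet_box 2 _), hmem]

theorem EA_zero : EA 0 = 3 / 16 := by
  have h0 : (0 : ℝ) ∈ Icc (0 : ℝ) 1 := ⟨le_rfl, zero_le_one⟩
  have hcap {s t : ℝ} (hs : 0 < s) (ht : 0 < t) : capArea 0 s t = 0 := by
    rw [capArea, max_eq_left (by linarith), max_eq_left (by linarith),
      max_eq_left (by linarith)]
    norm_num
  rw [EA_eq_integral, intervalIntegral_zero_one_congr (g := fun s t =>
      1 / 4 + (-1 / 4 * s) * t + 0 * t ^ 2 + 0 * t ^ 3 + 0 * t ^ 4 + 0 * t ^ 5)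
    fun s hs t ht => ?_]
  · have h (s : ℝ) := integral_quintic 0 1 (1 / 4) (-1 / 4 * s) 0 0 0 0
    simp_rw [h]
    rw [intervalIntegral.integral_congr (g := fun s => 1 / 4 + -1 / 8 * s + 0 * s ^ 2
      + 0 * s ^ 3 + 0 * s ^ 4 + 0 * s ^ 5) fun s _ => by ring, integral_quintic]
    norm_num
  · rw [unifOr_triA_zero_real_box hs.1 ht.1,
      unifOr_triAc_real_box h0 (Ioc_subset_Icc_self hs) (Ioc_subset_Icc_self ht),
      hcap hs.1 ht.1, localDisc]
    ring

theorem EA_formula {A : ℝ} (hA : A ∈ Icc (0 : ℝ) 1) :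
    EA A = (-135 + 120 * A + 175 * A ^ 2 - 288 * A ^ 3 + 112 * A ^ 4 - 2 * A ^ 6)
      / (360 * (A ^ 2 - 2)) := by
  rcases hA.1.eq_or_lt with rfl | hpos
  · rw [EA_zero]
    norm_num
  have hne : A ^ 2 - 2 ≠ 0 := by nlinarith [hA.2]
  set a : ℝ := 1 / (A ^ 2 / 2) with ha
  set b : ℝ := 1 / (1 - A ^ 2 / 2) with hb
  rw [EA_eq_integral, intervalIntegral_zero_one_congr
    (g := fun s t => quadForm ((a - b) / 4) (b / 4) (a * b / 2 - (a - b)) (-(a * b) / 2) (1 - b)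
      (capArea A s t) (s * t)) fun s hs t ht => ?_, integral_integral_quadForm hA]
  · have hb' : b = -2 / (A ^ 2 - 2) := by
      rw [hb, div_eq_div_iff (by contrapose! hne; linarith) hne]
      ring
    rw [hb', ha]
    field_simp
    ring
  · rw [unifOr_triA_real_box ⟨hpos, hA.2⟩ (Ioc_subset_Icc_self hs) (Ioc_subset_Icc_self ht),
      unifOr_triAc_real_box hA (Ioc_subset_Icc_self hs) (Ioc_subset_Icc_self ht),
      div_eq_mul_one_div (capArea A s t), div_eq_mul_one_div (s * t - capArea A s t), ← ha, ← hb]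
    simp only [localDisc, quadForm]
    ring

/-- For `A ∈ [0,1]`, the stratified sample based on the partition of `[0,1]²` by the
line of slope `−1` through `(A,0)` satisfies
`E L2² = (−135+120A+175A²−288A³+112A⁴−2A⁶)/(360(A²−2))`; this attains its minimum on
`[0,1]` at `A = 1`, where its value is `1/20`. -/
theorem stmt17 :
    (∀ A ∈ Set.Icc (0 : ℝ) 1,
        EA A = (-135 + 120 * A + 175 * A ^ 2 - 288 * A ^ 3 + 112 * A ^ 4 - 2 * A ^ 6)
          / (360 * (A ^ 2 - 2)))
    ∧ (∀ A ∈ Set.Icc (0 : ℝ) 1, EA 1 ≤ EA A)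
    ∧ EA 1 = 1 / 20 := by
  have h1 : EA 1 = 1 / 20 := by
    rw [EA_formula ⟨zero_le_one, le_rfl⟩]
    norm_num
  refine ⟨fun A hA => EA_formula hA, fun A hA => ?_, h1⟩
  obtain ⟨h0, hle⟩ := id hA
  have hneg : 360 * (A ^ 2 - 2) < 0 := by nlinarith
  have hfac : -99 + 21 * A + 178 * A ^ 2 - 110 * A ^ 3 + 2 * A ^ 4 + 2 * A ^ 5 ≤ 0 := by
    have h4 : A ^ 4 ≤ A ^ 3 := pow_le_pow_of_le_one h0 hle (by norm_num)
    have h5 : A ^ 5 ≤ A ^ 3 := pow_le_pow_of_le_one h0 hle (by norm_num)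
    have hq : 0 ≤ (1 - A) * (93 + 72 * A * (1 - A) - 34 * A ^ 2) := by
      refine mul_nonneg (sub_nonneg.2 hle) ?_
      nlinarith [mul_nonneg h0 (sub_nonneg.2 hle)]
    nlinarith
  rw [h1, EA_formula hA, le_div_iff_of_neg hneg]
  nlinarith [mul_nonneg (sub_nonneg.2 hle) (neg_nonneg.2 hfac)]
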